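/- arXiv:cs/0004007 — 3 statements merged into one kernel-verified Lean document; each statement's English description precedes it below -/
import Mathlib

section
/- For all integers k ≥ 1 and r ≥ 1 and every finite simple graph G on a vertex set V with |V| = n ≥ 1, there exists a finite family 𝒩 of subsets of V such that: (1) for every vertex a ∈ V there is some N ∈ 𝒩 with B_r(a) ⊆ N; (2) for every N ∈ 𝒩 there is some vertex a ∈ V with N ⊆ B_{2kr}(a); and (3) (∑_{N ∈ 𝒩} |N|)^k ≤ n^{k+1} (i.e. the total size of the family is at most n^{1+1/k}). (Existence part of the sparse neighborhood covers of Peleg, Lemma 7 of the paper: every graph has an (r,2kr)-neighborhood cover of size O(n^{1+1/k}).) -/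
namespace NeighborhoodCover

open Finset

variable {V : Type*} [DecidableEq V]

/-- The union of the sets `B u`, `u ∈ U`, that meet `Y`. -/
def grow (B : V → Finset V) (U Y : Finset V) : Finset V :=
  (U.filter fun u => ¬ Disjoint (B u) Y).biUnion B

theorem mem_iterate_grow {B : V → Finset V} {U : Finset V} {a : V} (ha : a ∈ U)
    (hB : a ∈ B a) (i : ℕ) : a ∈ (grow B U)^[i] {a} := by
  induction i with
  | zero => simp
  | succ i ih =>
    rw [Function.iterate_succ_apply']
    exact mem_biUnion.2 ⟨a, mem_filter.2 ⟨ha, not_disjoint_iff.2 ⟨a, hB, ih⟩⟩, hB⟩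

theorem iterate_grow_subset {B : V → Finset V} {U : Finset V} {a : V} (ha : a ∈ U)
    (hB : a ∈ B a) (i : ℕ) : (grow B U)^[i] {a} ⊆ U.biUnion B := by
  cases i with
  | zero => exact singleton_subset_iff.2 (mem_biUnion.2 ⟨a, ha, hB⟩)
  | succ i =>
    rw [Function.iterate_succ_apply']
    exact biUnion_subset_biUnion_of_subset_left _ (filter_subset _ _)

/-- A sequence of positive reals starting at `1` and bounded by `c ^ k` has a step among the
first `k` at which it grows by a factor of at most `c`. -/
theorem exists_slow_growth {c : ℝ} (hc : 0 ≤ c) {k : ℕ} (hk : 1 ≤ k) (f : ℕ → ℝ)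
    (h0 : f 0 = 1) (hf : f k ≤ c ^ k) : ∃ i < k, f (i + 1) ≤ c * f i := by
  by_contra! h
  have lower : ∀ i < k, c ^ (i + 1) < f (i + 1) := by
    intro i
    induction i with
    | zero => intro hi; simpa [h0] using h 0 hi
    | succ i ih =>
      intro hi
      calc c ^ (i + 1 + 1) = c * c ^ (i + 1) := pow_succ' _ _
        _ ≤ c * f (i + 1) := mul_le_mul_of_nonneg_left (ih (by omega)).le hc
        _ < f (i + 1 + 1) := h _ hi
  have := lower (k - 1) (by omega)
  rw [Nat.sub_add_cancel hk] at this
  exact this.not_ge hf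

/-- Sparse coarsening of the sets `B u`, `u ∈ U`, by iterated growth. -/
theorem exists_coarsening [Fintype V] (B : V → Finset V) (hB : ∀ a, a ∈ B a) {c : ℝ}
    (hc : 0 ≤ c) {k : ℕ} (hk : 1 ≤ k) (hn : (Fintype.card V : ℝ) ≤ c ^ k) (U : Finset V) :
    ∃ 𝒩 : Finset (Finset V),
      (∀ a ∈ U, ∃ N ∈ 𝒩, B a ⊆ N) ∧
      (∀ N ∈ 𝒩, ∃ (W : Finset V) (a : V), ∃ i ≤ k, N = (grow B W)^[i] {a}) ∧
      ∑ N ∈ 𝒩, (N.card : ℝ) ≤ c * (U.biUnion B).card := by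
  induction U using Finset.strongInduction with
  | H U ih =>
    obtain rfl | ⟨a, ha⟩ := U.eq_empty_or_nonempty
    · exact ⟨∅, by simp⟩
    obtain ⟨i, hik, hi⟩ := exists_slow_growth hc hk
      (fun i => (((grow B U)^[i] {a}).card : ℝ)) (by simp)
      (hn.trans' (by exact_mod_cast card_le_univ _))
    set Y := (grow B U)^[i] {a} with hY
    have hZ : (grow B U)^[i + 1] {a} = grow B U Y := Function.iterate_succ_apply' _ _ _
    rw [hZ] at hi
    have haY : a ∈ Y := mem_iterate_grow ha (hB a) i
    have hYU : Y ⊆ U.biUnion B := iterate_grow_subset ha (hB a) i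
    set U' := U.filter fun u => Disjoint (B u) Y with hU'
    have hss : U' ⊂ U := filter_ssubset.2 ⟨a, ha, not_disjoint_iff.2 ⟨a, hB a, haY⟩⟩
    obtain ⟨𝒩, hcov, hrad, hsize⟩ := ih U' hss
    refine ⟨insert (grow B U Y) 𝒩, fun u hu => ?_, fun N hN => ?_, ?_⟩
    · by_cases hd : Disjoint (B u) Y
      · obtain ⟨N, hN, hsub⟩ := hcov u (mem_filter.2 ⟨hu, hd⟩)
        exact ⟨N, mem_insert_of_mem hN, hsub⟩
      · exact ⟨_, mem_insert_self _ _, subset_biUnion_of_mem B (mem_filter.2 ⟨hu, hd⟩)⟩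
    · obtain rfl | hN := mem_insert.1 hN
      · exact ⟨U, a, i + 1, hik, hZ.symm⟩
      · exact hrad N hN
    · have hdisj : Disjoint Y (U'.biUnion B) :=
        (disjoint_biUnion_right _ _ _).2 fun u hu => (mem_filter.1 hu).2.symm
      have hcard : Y.card + (U'.biUnion B).card ≤ (U.biUnion B).card := by
        rw [← card_union_of_disjoint hdisj]
        exact card_le_card (union_subset hYU (biUnion_subset_biUnion_of_subset_left _ hss.1))
      have hcard' : (Y.card : ℝ) + (U'.biUnion B).card ≤ (U.biUnion B).card := by
        exact_mod_cast hcard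
      have hins : ∑ N ∈ insert (grow B U Y) 𝒩, (N.card : ℝ) ≤
          (grow B U Y).card + ∑ N ∈ 𝒩, (N.card : ℝ) := by
        by_cases hmem : grow B U Y ∈ 𝒩
        · rw [insert_eq_of_mem hmem]
          exact le_add_of_nonneg_left (Nat.cast_nonneg _)
        · rw [sum_insert hmem]
      have := mul_le_mul_of_nonneg_left hcard' hc
      linarith

theorem edist_le_of_mem_iterate_grow {G : SimpleGraph V} {r : ℕ} {B : V → Finset V}
    (hB : ∀ a b, b ∈ B a → G.edist a b ≤ r) {U : Finset V} {a : V} (i : ℕ) {b : V}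
    (hb : b ∈ (grow B U)^[i] {a}) : G.edist a b ≤ ((2 * i * r : ℕ) : ℕ∞) := by
  induction i generalizing b with
  | zero => simp_all
  | succ i ih =>
    rw [Function.iterate_succ_apply'] at hb
    obtain ⟨u, hu, hub⟩ := mem_biUnion.1 hb
    obtain ⟨y, huy, hy⟩ := not_disjoint_iff.1 (mem_filter.1 hu).2
    calc G.edist a b ≤ G.edist a y + (G.edist y u + G.edist u b) :=
          G.edist_triangle.trans (add_le_add_right G.edist_triangle _)
      _ ≤ ((2 * i * r : ℕ) : ℕ∞) + (r + r) := by
          rw [G.edist_comm (u := y)]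
          exact add_le_add (ih hy) (add_le_add (hB _ _ huy) (hB _ _ hub))
      _ = ((2 * (i + 1) * r : ℕ) : ℕ∞) := by push_cast; ring

end NeighborhoodCover

open NeighborhoodCover in
/-- **Existence part of Peleg's sparse neighborhood covers** (Lemma 7):
for all `k, r ≥ 1`, every finite simple graph on `n ≥ 1` vertices has an
`(r, 2kr)`-neighborhood cover of size at most `n^(1+1/k)`. -/
theorem neighborhood_cover_exists (k r : ℕ) (hk : 1 ≤ k) (hr : 1 ≤ r)
    (V : Type*) [Fintype V] [DecidableEq V] (G : SimpleGraph V)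
    (hn : 1 ≤ Fintype.card V) :
    ∃ 𝒩 : Finset (Finset V),
      (∀ a : V, ∃ N ∈ 𝒩, ∀ b : V, G.edist a b ≤ (r : ℕ∞) → b ∈ N) ∧
      (∀ N ∈ 𝒩, ∃ a : V, ∀ b ∈ N, G.edist a b ≤ ((2 * k * r : ℕ) : ℕ∞)) ∧
      (∑ N ∈ 𝒩, N.card) ^ k ≤ (Fintype.card V) ^ (k + 1) := by
  classical
  let B : V → Finset V := fun a => Finset.univ.filter fun b => G.edist a b ≤ r
  have hB : ∀ a b, b ∈ B a ↔ G.edist a b ≤ r := fun a b => by simp [B]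
  set c : ℝ := (Fintype.card V : ℝ) ^ ((k : ℝ)⁻¹)
  have hc : 0 ≤ c := by positivity
  have hck : c ^ k = Fintype.card V :=
    Real.rpow_inv_natCast_pow (Nat.cast_nonneg _) (by omega)
  obtain ⟨𝒩, hcov, hrad, hsize⟩ :=
    exists_coarsening B (fun a => (hB a a).2 (by simp)) hc hk hck.ge Finset.univ
  refine ⟨𝒩, fun a => ?_, fun N hN => ?_, ?_⟩
  · obtain ⟨N, hN, hsub⟩ := hcov a (Finset.mem_univ a)
    exact ⟨N, hN, fun b hb => hsub ((hB a b).2 hb)⟩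
  · obtain ⟨W, a, i, hik, rfl⟩ := hrad N hN
    refine ⟨a, fun b hb => (edist_le_of_mem_iterate_grow (fun a b => (hB a b).1) i hb).trans ?_⟩
    exact_mod_cast Nat.mul_le_mul_right r (Nat.mul_le_mul_left 2 hik)
  · have htotal : ∑ N ∈ 𝒩, (N.card : ℝ) ≤ c * Fintype.card V :=
      hsize.trans (mul_le_mul_of_nonneg_left (by exact_mod_cast Finset.card_le_univ _) hc)
    have hpow :=
      pow_le_pow_left₀ (Finset.sum_nonneg fun N _ => Nat.cast_nonneg N.card) htotal k
    rw [mul_pow, hck, ← pow_succ'] at hpow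
    exact_mod_cast hpow
end

section
/- Let G be a simple graph, r ∈ ℕ, and suppose the girth of G is strictly greater than 2r+1 (as an element of ℕ∞, where an acyclic graph has girth ∞). Then for every vertex a of G, the subgraph of G induced on the r-ball B_r(a) is acyclic. (This is the observation in Example 14 of the paper: if 2r+1 < g(G) then the local tree-width ltw^G(r) ≤ 1, i.e. r-neighborhoods induce forests.) -/
namespace SimpleGraph

/-- Two distinct paths with the same endpoints contain a cycle of length at most the sum of
their lengths. -/
theorem egirth_le_length_add_length {V : Type*} {G : SimpleGraph V} {u v : V} {p q : G.Walk u v}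
    (hp : p.IsPath) (hq : q.IsPath) (hpq : p ≠ q) :
    G.egirth ≤ ((p.length + q.length : ℕ) : ℕ∞) := by
  classical
  let s : Set (Sym2 V) := {e | e ∈ p.edges ++ q.edges}
  have hsG : ∀ e ∈ s, e ∈ G.edgeSet := by
    intro e he
    rcases List.mem_append.mp he with h | h
    · exact p.edges_subset_edgeSet h
    · exact q.edges_subset_edgeSet h
  have hle : fromEdgeSet s ≤ G := fun x y h ↦ hsG _ ((fromEdgeSet_adj s).mp h).1
  have hmem : ∀ e ∈ s, e ∈ (fromEdgeSet s).edgeSet := by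
    intro e he
    rw [edgeSet_fromEdgeSet]
    exact ⟨he, fun h ↦ G.not_isDiag_of_mem_edgeSet (hsG e he) h⟩
  have hp' : ∀ e ∈ p.edges, e ∈ (fromEdgeSet s).edgeSet := fun e he ↦
    hmem e (List.mem_append_left _ he)
  have hq' : ∀ e ∈ q.edges, e ∈ (fromEdgeSet s).edgeSet := fun e he ↦
    hmem e (List.mem_append_right _ he)
  have hcyc : ¬ (fromEdgeSet s).IsAcyclic := by
    intro h
    have heq := (h.subsingleton_path u v).elim ⟨_, hp.transfer hp'⟩ ⟨_, hq.transfer hq'⟩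
    apply hpq
    apply Walk.ext_support
    simpa using congrArg (fun w ↦ w.1.support) heq
  simp only [IsAcyclic, not_forall, not_not] at hcyc
  obtain ⟨w, c, hc⟩ := hcyc
  refine (egirth_le_length (hc.mapLe hle)).trans ?_
  rw [Walk.length_map, Nat.cast_le, ← c.length_edges, ← p.length_edges, ← q.length_edges,
    ← List.length_append]
  refine (hc.edges_nodup.subperm fun e he ↦ ?_).length_le
  have := c.edges_subset_edgeSet he
  rw [edgeSet_fromEdgeSet] at this
  exact this.1

/-- A vertex `v` having two distinct neighbours that are no further from `a` than `v` is
forces a cycle of length at most `2 * G.dist a v + 1`. -/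
theorem egirth_le_two_mul_dist_add_one {V : Type*} {G : SimpleGraph V} {a v x y : V}
    (hav : G.Reachable a v) (hxv : G.Adj x v) (hyv : G.Adj y v) (hxy : x ≠ y)
    (hx : G.dist a x ≤ G.dist a v) (hy : G.dist a y ≤ G.dist a v) :
    G.egirth ≤ ((2 * G.dist a v + 1 : ℕ) : ℕ∞) := by
  classical
  have key : ∀ z, G.Adj z v → G.dist a z ≤ G.dist a v →
      ∃ p : G.Walk a v, p.IsPath ∧ p.length = G.dist a z + 1 ∧ p.penultimate = z := by
    intro z hzv hz
    obtain ⟨p, hp, hpl⟩ := (hav.trans hzv.symm.reachable).exists_path_of_dist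
    refine ⟨p.concat hzv, hp.concat (fun hv ↦ ?_) hzv, by simp [hpl], by simp⟩
    have h1 := dist_le (p.takeUntil v hv)
    have h2 := p.length_takeUntil_lt_length hv hzv.ne'
    omega
  obtain ⟨p, hp, hpl, hpx⟩ := key x hxv hx
  obtain ⟨q, hq, hql, hqy⟩ := key y hyv hy
  obtain ⟨s, hs, hsl⟩ := hav.exists_path_of_dist
  by_cases hxd : G.dist a x = G.dist a v
  · refine (egirth_le_length_add_length hp hs ?_).trans (Nat.cast_le.mpr (by omega))
    rintro rfl
    omega
  by_cases hyd : G.dist a y = G.dist a v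
  · refine (egirth_le_length_add_length hq hs ?_).trans (Nat.cast_le.mpr (by omega))
    rintro rfl
    omega
  refine (egirth_le_length_add_length hp hq ?_).trans (Nat.cast_le.mpr (by omega))
  rintro rfl
  exact hxy (hpx.symm.trans hqy)

end SimpleGraph

/-- **Observation in Example 14**: if the girth of `G` (as an element of `ℕ∞`,
`∞` for acyclic graphs) is strictly greater than `2r+1`, then the subgraph of `G`
induced on every `r`-ball is acyclic. -/
theorem ball_induced_acyclic_of_large_girth {V : Type*} (G : SimpleGraph V) (r : ℕ)
    (hgirth : ((2 * r + 1 : ℕ) : ℕ∞) < G.egirth) (a : V) :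
    (G.induce {b : V | G.edist a b ≤ (r : ℕ∞)}).IsAcyclic := by
  classical
  intro u c hc
  obtain ⟨v, hv, hmax⟩ := c.support.toFinset.exists_max_image (fun z ↦ G.dist a z)
    ⟨u, by simp⟩
  simp only [List.mem_toFinset] at hv hmax
  have hc' := hc.rotate hv
  have hmem : ∀ z ∈ (c.rotate v hv).support, z ∈ c.support := by simp
  have hreach : G.Reachable a v := by
    rw [← SimpleGraph.edist_ne_top_iff_reachable]
    exact ne_top_of_le_ne_top (ENat.natCast_ne_top r) v.2
  have hdist : G.dist a v ≤ r := by
    have h : G.edist a v ≤ r := v.2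
    rwa [← hreach.coe_dist_eq_edist, Nat.cast_le] at h
  have h := SimpleGraph.egirth_le_two_mul_dist_add_one (G := G) hreach
    (x := (c.rotate v hv).snd.1) (y := (c.rotate v hv).penultimate.1)
    ((c.rotate v hv).adj_snd hc'.not_nil).symm
    ((c.rotate v hv).adj_penultimate hc'.not_nil)
    (fun h ↦ hc'.snd_ne_penultimate (Subtype.ext h))
    (hmax _ (hmem _ (SimpleGraph.Walk.getVert_mem_support _ _)))
    (hmax _ (hmem _ (SimpleGraph.Walk.getVert_mem_support _ _)))
  exact (hgirth.trans_le (h.trans (Nat.cast_le.mpr (by omega)))).false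
end

section
/- Let k ≥ 1 and w ≥ 1, and let G be a finite simple graph on a vertex set V with |V| = n ≥ 1 such that for every vertex a the subgraph of G induced on the ball B_{2k}(a) admits a tree decomposition of width at most w. Then the number of edges of G satisfies |E(G)|^k ≤ w^k · n^{k+1} (i.e. |E(G)| ≤ w·n^{1+1/k}). (Graph version of Corollary 9 of the paper: for a class of structures of bounded local tree-width, the size of every structure is at most c·n^{1+1/k}.) -/
/-- `G` admits a tree decomposition of width at most `w`: there are a finite tree `T`
(a connected acyclic simple graph) and bags `B t ⊆ V` such that for every vertex `v`
the set of bags containing `v` is nonempty and induces a connected subgraph of `T`,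
every edge of `G` is contained in some bag, and every bag has at most `w + 1` elements. -/
def HasTreeDecompositionOfWidthLE {V : Type*} (G : SimpleGraph V) (w : ℕ) : Prop :=
  ∃ (ι : Type) (_ : Fintype ι) (T : SimpleGraph ι) (B : ι → Set V),
    T.Connected ∧ T.IsAcyclic ∧
    (∀ v : V, {t : ι | v ∈ B t}.Nonempty) ∧
    (∀ v : V, (T.induce {t : ι | v ∈ B t}).Connected) ∧
    (∀ u v : V, G.Adj u v → ∃ t : ι, u ∈ B t ∧ v ∈ B t) ∧
    (∀ t : ι, (B t).ncard ≤ w + 1)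

namespace SimpleGraph

/-- In a connected graph, if `S` induces a connected subgraph and `t` is a point of `S`
closest to `r`, then from each `s ∈ S` there is a path through `t` to `r` whose vertices are in `S`
or strictly closer to `r` than `t`. -/
theorem exists_isPath_through_closest {ι : Type*} {T : SimpleGraph ι} (hT : T.Connected)
    {S : Set ι} (hS : (T.induce S).Connected) {r s t : ι} (hs : s ∈ S) (ht : t ∈ S)
    (hmin : ∀ x ∈ S, T.dist t r ≤ T.dist x r) :
    ∃ p : T.Walk s r, p.IsPath ∧ t ∈ p.support ∧
      ∀ x ∈ p.support, x ∈ S ∨ T.dist x r < T.dist t r := by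
  classical
  obtain ⟨q₀, hq₀⟩ := (hS.preconnected ⟨s, hs⟩ ⟨t, ht⟩).exists_isPath
  let φ : T.induce S ↪g T := Embedding.induce S
  let q : T.Walk s t := q₀.map φ.toHom
  have hq : q.IsPath := hq₀.map φ.injective
  have hqS : ∀ x ∈ q.support, x ∈ S := by
    intro x hx
    obtain ⟨y, -, rfl⟩ := List.mem_map.mp (Walk.support_map φ.toHom q₀ ▸ hx)
    exact y.2
  obtain ⟨q', hq', hlen⟩ := hT.exists_path_of_dist t r
  have hclose : ∀ x ∈ q'.support, x = t ∨ T.dist x r < T.dist t r := by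
    intro x hx
    by_cases hxt : x = t
    · exact Or.inl hxt
    · right
      have h₁ := dist_le (q'.dropUntil x hx)
      have h₂ := congrArg Walk.length (q'.take_spec hx)
      rw [Walk.length_append] at h₂
      have h₃ : 0 < (q'.takeUntil x hx).length := by
        rw [Nat.pos_iff_ne_zero]
        intro h
        exact hxt (Walk.eq_of_length_eq_zero h).symm
      omega
  refine ⟨q.append q', ?_, ?_, ?_⟩
  · rw [Walk.isPath_def, Walk.support_append, List.nodup_append']
    refine ⟨hq.support_nodup, hq'.support_nodup.sublist (List.tail_sublist _), ?_⟩
    intro x hx hx'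
    rcases hclose x (List.mem_of_mem_tail hx') with rfl | h
    · have := hq'.support_nodup
      rw [← Walk.cons_tail_support] at this
      exact (List.nodup_cons.mp this).1 hx'
    · exact absurd (hmin x (hqS x hx)) (not_le.mpr h)
  · simp [Walk.mem_support_append_iff]
  · intro x hx
    rcases Walk.mem_support_append_iff _ _ |>.mp hx with h | h
    · exact Or.inl (hqS x h)
    · rcases hclose x h with rfl | h
      · exact Or.inl ht
      · exact Or.inr h

/-- Of two intersecting connected vertex sets of a tree, the one whose closest point to `r` is
nearer to `r` contains the closest point of the other. -/
theorem closest_mem_of_connected_of_inter {ι : Type*} {T : SimpleGraph ι} (hT : T.Connected)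
    (hA : T.IsAcyclic) {S S' : Set ι} (hS : (T.induce S).Connected)
    (hS' : (T.induce S').Connected) {r s t t' : ι} (hs : s ∈ S) (hs' : s ∈ S')
    (ht : t ∈ S) (ht' : t' ∈ S') (hmin : ∀ x ∈ S, T.dist t r ≤ T.dist x r)
    (hmin' : ∀ x ∈ S', T.dist t' r ≤ T.dist x r) (hle : T.dist t' r ≤ T.dist t r) :
    t ∈ S' := by
  obtain ⟨p, hp, htp, -⟩ := exists_isPath_through_closest hT hS hs ht hmin
  obtain ⟨p', hp', -, hsup⟩ := exists_isPath_through_closest hT hS' hs' ht' hmin'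
  have hpp : p = p' := congrArg Subtype.val ((hA.subsingleton_path s r).elim ⟨p, hp⟩ ⟨p', hp'⟩)
  subst hpp
  exact (hsup t htp).resolve_right (not_lt.mpr hle)

/-- A graph of tree-width at most `w` has an orientation of out-degree at most `w`. -/
theorem _root_.HasTreeDecompositionOfWidthLE.exists_orientation {V : Type*} [Finite V]
    {G : SimpleGraph V} {w : ℕ} (h : HasTreeDecompositionOfWidthLE G w) :
    ∃ P : V → Set V, (∀ v, (P v).ncard ≤ w) ∧ ∀ u v, G.Adj u v → u ∈ P v ∨ v ∈ P u := by
  obtain ⟨ι, _, T, B, hT, hA, hne, hconn, hedge, hcard⟩ := h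
  obtain ⟨r⟩ := hT.nonempty
  have htop : ∀ v, ∃ t, v ∈ B t ∧ ∀ x, v ∈ B x → T.dist t r ≤ T.dist x r := by
    intro v
    obtain ⟨t, ht, hm⟩ :=
      Set.exists_min_image {t | v ∈ B t} (fun t => T.dist t r) (Set.toFinite _) (hne v)
    exact ⟨t, ht, hm⟩
  choose t ht hmin using htop
  refine ⟨fun v => B (t v) \ {v}, fun v => ?_, fun u v huv => ?_⟩
  · rw [Set.ncard_sdiff_singleton_of_mem (ht v)]
    have := hcard (t v)
    omega
  · obtain ⟨s, hu, hv⟩ := hedge u v huv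
    rcases le_total (T.dist (t u) r) (T.dist (t v) r) with hle | hle
    · exact Or.inl ⟨closest_mem_of_connected_of_inter hT hA (hconn v) (hconn u) hv hu (ht v) (ht u)
        (hmin v) (hmin u) hle, huv.ne⟩
    · exact Or.inr ⟨closest_mem_of_connected_of_inter hT hA (hconn u) (hconn v) hu hv (ht u) (ht v)
        (hmin u) (hmin v) hle, huv.ne'⟩

variable {V : Type*} [DecidableEq V] (G : SimpleGraph V) [DecidableRel G.Adj]

/-- If `G` has tree-width at most `w` on a set containing `X`, then at most `w * #X` edges of `G`
lie inside `X`. -/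
theorem card_edgeFinset_inter_sym2_le [Fintype V] {w : ℕ} {S : Set V}
    (h : HasTreeDecompositionOfWidthLE (G.induce S) w) {X : Finset V} (hX : ∀ x ∈ X, x ∈ S) :
    (G.edgeFinset ∩ X.sym2).card ≤ w * X.card := by
  classical
  obtain ⟨P, hP, hadj⟩ := h.exists_orientation
  let Q : X → Finset V := fun v => ((P ⟨v, hX v v.2⟩).toFinset).map (Function.Embedding.subtype _)
  have hsub : G.edgeFinset ∩ X.sym2 ⊆
      X.attach.biUnion fun v => (Q v).image fun u => s(u, (v : V)) := by
    intro e
    induction e using Sym2.ind with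
    | _ u v =>
      intro he
      rw [Finset.mem_inter, mem_edgeFinset, mem_edgeSet, Finset.mk_mem_sym2_iff] at he
      obtain ⟨huv, hu, hv⟩ := he
      simp only [Finset.mem_biUnion, Finset.mem_image, Finset.mem_attach, true_and]
      rcases hadj ⟨u, hX u hu⟩ ⟨v, hX v hv⟩ huv with h | h
      · exact ⟨⟨v, hv⟩, u, by simpa [Q] using ⟨hX u hu, h⟩, rfl⟩
      · exact ⟨⟨u, hu⟩, v, by simpa [Q] using ⟨hX v hv, h⟩, Sym2.eq_swap⟩
  calc (G.edgeFinset ∩ X.sym2).card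
      ≤ ∑ v ∈ X.attach, ((Q v).image fun u => s(u, (v : V))).card :=
        (Finset.card_le_card hsub).trans Finset.card_biUnion_le
    _ ≤ ∑ _v ∈ X.attach, w := by
        refine Finset.sum_le_sum fun v _ => Finset.card_image_le.trans ?_
        rw [Finset.card_map, ← Set.ncard_eq_toFinset_card']
        exact hP _
    _ = w * X.card := by simp [mul_comm]

/-- The ball of radius `i` around `a` in the subgraph of `G` induced on `U`. -/
def ballWithin (U : Finset V) (a : V) : ℕ → Finset V
  | 0 => {a}
  | i + 1 => ballWithin U a i ∪ U.filter fun v => ∃ u ∈ ballWithin U a i, G.Adj u v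

theorem ballWithin_subset_succ (U : Finset V) (a : V) (i : ℕ) :
    G.ballWithin U a i ⊆ G.ballWithin U a (i + 1) :=
  Finset.subset_union_left

theorem mem_ballWithin_self (U : Finset V) (a : V) (i : ℕ) : a ∈ G.ballWithin U a i := by
  induction i with
  | zero => simp [ballWithin]
  | succ i ih => exact G.ballWithin_subset_succ U a i ih

theorem ballWithin_subset {U : Finset V} {a : V} (ha : a ∈ U) (i : ℕ) :
    G.ballWithin U a i ⊆ U := by
  induction i with
  | zero => simpa [ballWithin] using ha
  | succ i ih => exact Finset.union_subset ih (Finset.filter_subset _ _)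

theorem edist_le_of_mem_ballWithin {U : Finset V} {a b : V} {i : ℕ}
    (hb : b ∈ G.ballWithin U a i) : G.edist a b ≤ i := by
  induction i generalizing b with
  | zero =>
    rw [ballWithin, Finset.mem_singleton] at hb
    simp [hb]
  | succ i ih =>
    rw [ballWithin, Finset.mem_union, Finset.mem_filter] at hb
    rcases hb with hb | ⟨-, u, hu, hub⟩
    · exact (ih hb).trans (by exact_mod_cast Nat.le_succ i)
    · calc G.edist a b ≤ G.edist a u + G.edist u b := G.edist_triangle
        _ ≤ (i : ℕ∞) + 1 := add_le_add (ih hu) (edist_eq_one_iff_adj.mpr hub).le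
        _ = ((i + 1 : ℕ) : ℕ∞) := by push_cast; rfl

theorem edgeFinset_inter_sym2_subset_ballWithin [Fintype V] (U : Finset V) (a : V)
    (i : ℕ) : G.edgeFinset ∩ U.sym2 ⊆ (G.edgeFinset ∩ (U \ G.ballWithin U a i).sym2) ∪
      (G.edgeFinset ∩ (G.ballWithin U a (i + 1)).sym2) := by
  intro e
  induction e using Sym2.ind with
  | _ u v =>
    simp only [Finset.mem_inter, Finset.mem_union, mem_edgeFinset, mem_edgeSet,
      Finset.mk_mem_sym2_iff, Finset.mem_sdiff, ballWithin, Finset.mem_filter]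
    rintro ⟨huv, hu, hv⟩
    have huv' := huv.symm
    by_cases h₁ : u ∈ G.ballWithin U a i <;> by_cases h₂ : v ∈ G.ballWithin U a i
    · tauto
    · exact Or.inr ⟨huv, Or.inl h₁, Or.inr ⟨hv, u, h₁, huv⟩⟩
    · exact Or.inr ⟨huv, Or.inr ⟨hu, v, h₂, huv'⟩, Or.inl h₂⟩
    · tauto

/-- Among `k` consecutive ball sizes, one grows by a factor of at most `c`, if `c ^ k = |V|`. -/
theorem exists_card_ballWithin_succ_le [Fintype V] {k : ℕ} {c : ℝ} (hk : k ≠ 0) (hc : 0 < c)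
    (hck : c ^ k = Fintype.card V) (U : Finset V) (a : V) :
    ∃ i < k, ((G.ballWithin U a (i + 1)).card : ℝ) ≤ c * (G.ballWithin U a i).card := by
  by_contra! hcon
  have hgrow : ∀ i ≤ k, c ^ i ≤ (G.ballWithin U a i).card ∧
      (i ≠ 0 → c ^ i < (G.ballWithin U a i).card) := by
    intro i
    induction i with
    | zero => simp [ballWithin]
    | succ i ih =>
      intro hi
      have h₁ := hcon i hi
      have h₂ := mul_le_mul_of_nonneg_left (ih (by omega)).1 hc.le
      rw [pow_succ']
      exact ⟨(h₂.trans_lt h₁).le, fun _ => h₂.trans_lt h₁⟩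
  have h₁ := (hgrow k le_rfl).2 hk
  rw [hck] at h₁
  exact absurd (Finset.card_le_univ (G.ballWithin U a k)) (not_le.mpr (by exact_mod_cast h₁))

/-- If all balls of radius `m ≥ k` have tree-width at most `w`, then each vertex set `U` spans at
most `w * |V| ^ (1 / k) * #U` edges. -/
theorem card_edgeFinset_inter_sym2_le_of_local [Fintype V] {k m w : ℕ} {c : ℝ}
    (hk : k ≠ 0) (hkm : k ≤ m) (hc : 0 < c) (hck : c ^ k = Fintype.card V)
    (hloc : ∀ a : V, HasTreeDecompositionOfWidthLE (G.induce {b : V | G.edist a b ≤ (m : ℕ∞)}) w)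
    (U : Finset V) : ((G.edgeFinset ∩ U.sym2).card : ℝ) ≤ w * c * U.card := by
  induction U using Finset.strongInduction with
  | H U ih =>
    obtain rfl | ⟨a, ha⟩ := U.eq_empty_or_nonempty
    · simp
    obtain ⟨i, hik, hi⟩ := G.exists_card_ballWithin_succ_le hk hc hck U a
    have hsub := G.ballWithin_subset ha i
    have hrest := ih (U \ G.ballWithin U a i)
      (Finset.sdiff_ssubset hsub ⟨a, G.mem_ballWithin_self U a i⟩)
    have hball : ((G.edgeFinset ∩ (G.ballWithin U a (i + 1)).sym2).card : ℝ) ≤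
        w * (G.ballWithin U a (i + 1)).card := by
      exact_mod_cast G.card_edgeFinset_inter_sym2_le (hloc a) fun x hx =>
        (G.edist_le_of_mem_ballWithin hx).trans (Nat.cast_le.mpr (hik.trans_le hkm))
    have hsplit : ((G.edgeFinset ∩ U.sym2).card : ℝ) ≤
        (G.edgeFinset ∩ (U \ G.ballWithin U a i).sym2).card +
          (G.edgeFinset ∩ (G.ballWithin U a (i + 1)).sym2).card := by
      exact_mod_cast (Finset.card_le_card
        (G.edgeFinset_inter_sym2_subset_ballWithin U a i)).trans (Finset.card_union_le _ _)
    have hcard : ((U \ G.ballWithin U a i).card : ℝ) + (G.ballWithin U a i).card = U.card := by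
      exact_mod_cast Finset.card_sdiff_add_card_eq_card hsub
    have hmul := mul_le_mul_of_nonneg_left hi (Nat.cast_nonneg (α := ℝ) w)
    rw [← hcard]
    linarith

end SimpleGraph

/-- **Graph version of Corollary 9**: if `k, w ≥ 1` and in a finite graph `G` on
`n ≥ 1` vertices every `2k`-ball induces a subgraph of tree-width at most `w`,
then `|E(G)|^k ≤ w^k · n^(k+1)`, i.e. `|E(G)| ≤ w · n^(1+1/k)`. -/
theorem edge_card_le_of_local_treewidth {V : Type*} [Fintype V] [DecidableEq V]
    (G : SimpleGraph V) [DecidableRel G.Adj] (k w : ℕ) (hk : 1 ≤ k) (hw : 1 ≤ w)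
    (hn : 1 ≤ Fintype.card V)
    (hloc : ∀ a : V,
      HasTreeDecompositionOfWidthLE
        (G.induce {b : V | G.edist a b ≤ ((2 * k : ℕ) : ℕ∞)}) w) :
    G.edgeFinset.card ^ k ≤ w ^ k * (Fintype.card V) ^ (k + 1) := by
  have hk0 : k ≠ 0 := by omega
  have hn0 : (0 : ℝ) < Fintype.card V := by exact_mod_cast hn
  set c : ℝ := (Fintype.card V : ℝ) ^ ((k : ℝ)⁻¹)
  have hc : 0 < c := Real.rpow_pos_of_pos hn0 _
  have hck : c ^ k = Fintype.card V := Real.rpow_inv_natCast_pow hn0.le hk0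
  have h := G.card_edgeFinset_inter_sym2_le_of_local hk0 (by omega) hc hck hloc Finset.univ
  rw [Finset.sym2_univ, Finset.inter_univ, Finset.card_univ] at h
  have h' := pow_le_pow_left₀ (Nat.cast_nonneg _) h k
  rw [mul_pow, mul_pow, hck, mul_assoc, ← pow_succ'] at h'
  exact_mod_cast h'
end
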